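/- Starting from a configuration with no bad nodes, no execution can perform an infinite number of height updates: in any execution whose initial configuration contains no bad nodes, the total number of height-update actions performed (summed over all steps and all activated nodes) is finite. -/

import Mathlib

open scoped Classical

/-- A pre-configuration: a finite node set `V` with a partial parent map
(`none` means the node has no parent) and an integer height assignment. -/
structure PreConfig (V : Type*) where
  parent : V → Option V
  height : V → ℤ

namespace PreConfig

variable {V : Type*} [Fintype V] [LinearOrder V]

/-- The children of `u` are the nodes whose parent is `u`. -/
noncomputable def children (C : PreConfig V) (u : V) : Finset V :=
  Finset.univ.filter (fun v => C.parent v = some u)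

/-- A leaf is a node with no children. -/
def IsLeaf (C : PreConfig V) (u : V) : Prop := C.children u = ∅

/-- Maximum height value among the children of `u` (junk value `0` for a leaf). -/
noncomputable def maxH (C : PreConfig V) (u : V) : ℤ :=
  if h : (C.children u).Nonempty then (C.children u).sup' h C.height else 0

/-- Minimum height value among the children of `u` (junk value `0` for a leaf). -/
noncomputable def minH (C : PreConfig V) (u : V) : ℤ :=
  if h : (C.children u).Nonempty then (C.children u).inf' h C.height else 0

/-- A child of `u` of maximum height value; ties broken by a fixed rule
(smallest ID). Junk value `u` for a leaf. -/
noncomputable def maxChild (C : PreConfig V) (u : V) : V :=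
  if h : ((C.children u).filter fun v => C.height v = C.maxH u).Nonempty
  then ((C.children u).filter fun v => C.height v = C.maxH u).min' h else u

/-- A child of `u` of minimum height value; ties broken by a fixed rule
(smallest ID). Junk value `u` for a leaf. -/
noncomputable def minChild (C : PreConfig V) (u : V) : V :=
  if h : ((C.children u).filter fun v => C.height v = C.minH u).Nonempty
  then ((C.children u).filter fun v => C.height v = C.minH u).min' h else u

/-- `stable(u)`: `h(u) = 0` if `u` is a leaf, and `h(u) = 1 + max_{w child of u} h(w)` otherwise. -/
def Stable (C : PreConfig V) (u : V) : Prop :=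
  (C.IsLeaf u ∧ C.height u = 0) ∨ (¬ C.IsLeaf u ∧ C.height u = 1 + C.maxH u)

/-- `balanced(u)`: `|h(z) − h(z')| ≤ α` for all children `z, z'` of `u`. -/
def Balanced (α : ℤ) (C : PreConfig V) (u : V) : Prop :=
  ∀ z ∈ C.children u, ∀ z' ∈ C.children u, |C.height z - C.height z'| ≤ α

/-- `u` is enabled for a height update iff `¬stable(u)`. -/
def UpdateEnabled (C : PreConfig V) (u : V) : Prop := ¬ C.Stable u

/-- `u` is enabled for a swap iff `stable(u) ∧ stable(max(u)) ∧ ¬balanced(u)`. -/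
def SwapEnabled (α : ℤ) (C : PreConfig V) (u : V) : Prop :=
  C.Stable u ∧ C.Stable (C.maxChild u) ∧ ¬ Balanced α C u

/-- `u` is enabled iff it is enabled for a height update or for a swap. -/
def Enabled (α : ℤ) (C : PreConfig V) (u : V) : Prop :=
  C.UpdateEnabled u ∨ SwapEnabled α C u

/-- The value written by a height update: `0` for a leaf, `1 + max_{w child of u} h(w)` otherwise. -/
noncomputable def newHeight (C : PreConfig V) (u : V) : ℤ :=
  if C.IsLeaf u then 0 else 1 + C.maxH u

/-- A bad node: an internal node `u` with `h(u) ≤ max_{v child of u} h(v)`,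
or a leaf `u` with `h(u) < 0`. -/
def Bad (C : PreConfig V) (u : V) : Prop :=
  (¬ C.IsLeaf u ∧ C.height u ≤ C.maxH u) ∨ (C.IsLeaf u ∧ C.height u < 0)

/-- `v` reaches `a` by iterating the parent map. -/
def Reaches (C : PreConfig V) (v a : V) : Prop :=
  Relation.ReflTransGen (fun x y => C.parent x = some y) v a

/-- The underlying graph is a rooted tree with root `r`: `r` has no parent,
every other node has a (unique) parent, and every node reaches `r` by
iterating the parent map. -/
def IsTree (C : PreConfig V) (r : V) : Prop :=
  C.parent r = none ∧ (∀ v, C.parent v = none → v = r) ∧ ∀ v, C.Reaches v r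

/-- The subtree `S_u` of `u`: the set of descendants of `u` (including `u`). -/
def subtree (C : PreConfig V) (u : V) : Set V := {v | C.Reaches v u}

/-- The actual height `h*(u)` of `u`: the length of a longest directed path
going downward from `u` (such a maximal path necessarily ends at a leaf of `S_u`). -/
noncomputable def hstar (C : PreConfig V) (u : V) : ℕ :=
  sSup {n : ℕ | ∃ f : ℕ → V, f 0 = u ∧ ∀ i < n, C.parent (f (i + 1)) = some (f i)}

/-- An execution step `C →_A C'`: a nonempty set `A` of nodes enabled in `C` is
activated simultaneously; each `u ∈ A` enabled for a height update sets its height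
to `newHeight`; each `u ∈ A` enabled for a swap replaces the edges `(u, min(u))` and
`(max(u), max(max(u)))` by `(u, max(max(u)))` and `(max(u), min(u))` (all guards and
functions evaluated in `C`); everything else is unchanged. -/
structure Step (α : ℤ) (C C' : PreConfig V) (A : Finset V) : Prop where
  nonempty : A.Nonempty
  all_enabled : ∀ u ∈ A, Enabled α C u
  height_update : ∀ u ∈ A, C.UpdateEnabled u → C'.height u = C.newHeight u
  height_keep : ∀ u, ¬ (u ∈ A ∧ C.UpdateEnabled u) → C'.height u = C.height u
  swap_out : ∀ u ∈ A, SwapEnabled α C u → C'.parent (C.minChild u) = some (C.maxChild u)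
  swap_in : ∀ u ∈ A, SwapEnabled α C u → C'.parent (C.maxChild (C.maxChild u)) = some u
  parent_keep : ∀ v, (∀ u ∈ A, SwapEnabled α C u →
      v ≠ C.minChild u ∧ v ≠ C.maxChild (C.maxChild u)) → C'.parent v = C.parent v

end PreConfig

namespace PreConfig

variable {V : Type*} [Fintype V] [LinearOrder V]

/-- All heights are nonnegative and strictly increase along every edge towards the root. -/
def Increasing (C : PreConfig V) : Prop :=
  (∀ u, 0 ≤ C.height u) ∧ ∀ v p, C.parent v = some p → C.height v < C.height p

theorem mem_children {C : PreConfig V} {u v : V} : v ∈ C.children u ↔ C.parent v = some u := by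
  simp [children]

theorem not_isLeaf_iff {C : PreConfig V} {u : V} : ¬ C.IsLeaf u ↔ (C.children u).Nonempty :=
  Finset.nonempty_iff_ne_empty.symm

theorem height_le_maxH {C : PreConfig V} {u v : V} (h : C.parent v = some u) :
    C.height v ≤ C.maxH u := by
  have hv : v ∈ C.children u := mem_children.2 h
  rw [maxH, dif_pos ⟨v, hv⟩]
  exact Finset.le_sup' C.height hv

theorem minH_le_height {C : PreConfig V} {u v : V} (h : C.parent v = some u) :
    C.minH u ≤ C.height v := by
  have hv : v ∈ C.children u := mem_children.2 h
  rw [minH, dif_pos ⟨v, hv⟩]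
  exact Finset.inf'_le C.height hv

theorem maxChild_spec {C : PreConfig V} {u : V} (h : ¬ C.IsLeaf u) :
    C.parent (C.maxChild u) = some u ∧ C.height (C.maxChild u) = C.maxH u := by
  have hne := not_isLeaf_iff.1 h
  obtain ⟨v, hv, hvm⟩ := Finset.exists_mem_eq_sup' hne C.height
  have hf : ((C.children u).filter fun v => C.height v = C.maxH u).Nonempty :=
    ⟨v, Finset.mem_filter.2 ⟨hv, by rw [maxH, dif_pos hne, hvm]⟩⟩
  have hmem := Finset.mem_filter.1 (Finset.min'_mem _ hf)
  rw [maxChild, dif_pos hf]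
  exact ⟨mem_children.1 hmem.1, hmem.2⟩

theorem minChild_spec {C : PreConfig V} {u : V} (h : ¬ C.IsLeaf u) :
    C.parent (C.minChild u) = some u ∧ C.height (C.minChild u) = C.minH u := by
  have hne := not_isLeaf_iff.1 h
  obtain ⟨v, hv, hvm⟩ := Finset.exists_mem_eq_inf' hne C.height
  have hf : ((C.children u).filter fun v => C.height v = C.minH u).Nonempty :=
    ⟨v, Finset.mem_filter.2 ⟨hv, by rw [minH, dif_pos hne, hvm]⟩⟩
  have hmem := Finset.mem_filter.1 (Finset.min'_mem _ hf)
  rw [minChild, dif_pos hf]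
  exact ⟨mem_children.1 hmem.1, hmem.2⟩

theorem increasing_of_not_bad {C : PreConfig V} (h : ∀ u, ¬ C.Bad u) : C.Increasing := by
  have hlt : ∀ v p, C.parent v = some p → C.height v < C.height p := by
    intro v p hp
    have hl : ¬ C.IsLeaf p := not_isLeaf_iff.2 ⟨v, mem_children.2 hp⟩
    by_contra hc
    exact h p (Or.inl ⟨hl, (not_lt.1 hc).trans (height_le_maxH hp)⟩)
  refine ⟨fun u => ?_, hlt⟩
  obtain ⟨w, -, hw⟩ := Finset.exists_min_image Finset.univ C.height ⟨u, Finset.mem_univ u⟩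
  refine le_trans ?_ (hw u (Finset.mem_univ u))
  by_contra hneg
  by_cases hl : C.IsLeaf w
  · exact h w (Or.inr ⟨hl, not_le.1 hneg⟩)
  · obtain ⟨v, hv⟩ := not_isLeaf_iff.1 hl
    exact absurd (hlt v w (mem_children.1 hv)) (not_lt.2 (hw v (Finset.mem_univ v)))

theorem Increasing.newHeight_lt {C : PreConfig V} (hC : C.Increasing) {u : V}
    (hu : C.UpdateEnabled u) : C.newHeight u < C.height u := by
  rw [UpdateEnabled, Stable, not_or, not_and, not_and] at hu
  unfold newHeight
  split_ifs with hl
  · exact lt_of_le_of_ne (hC.1 u) (Ne.symm (hu.1 hl))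
  · obtain ⟨hp, hm⟩ := maxChild_spec hl
    have h1 := hC.2 _ _ hp
    have h2 := hu.2 hl
    omega

theorem Increasing.newHeight_nonneg {C : PreConfig V} (hC : C.Increasing) (u : V) :
    0 ≤ C.newHeight u := by
  unfold newHeight
  split_ifs with hl
  · exact le_rfl
  · have h1 := hC.1 (C.maxChild u)
    rw [(maxChild_spec hl).2] at h1
    omega

theorem height_lt_newHeight {C : PreConfig V} {u v : V} (h : C.parent v = some u) :
    C.height v < C.newHeight u := by
  rw [newHeight, if_neg (not_isLeaf_iff.2 ⟨v, mem_children.2 h⟩)]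
  have := height_le_maxH h
  omega

/-- In an increasing configuration, the edges created by a swap are again increasing. -/
theorem Increasing.swap_height_lt {α : ℤ} (hα : 1 ≤ α) {C : PreConfig V} (hC : C.Increasing)
    {u : V} (hu : SwapEnabled α C u) :
    C.height (C.minChild u) < C.height (C.maxChild u) ∧
      C.height (C.maxChild (C.maxChild u)) < C.height u := by
  obtain ⟨-, hm, hb⟩ := hu
  simp only [Balanced, not_forall, not_le] at hb
  obtain ⟨z, hz, z', hz', hgap⟩ := hb
  have hl : ¬ C.IsLeaf u := not_isLeaf_iff.2 ⟨z, hz⟩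
  rw [mem_children] at hz hz'
  obtain ⟨hmaxp, hmax⟩ := maxChild_spec hl
  obtain ⟨-, hmin⟩ := minChild_spec hl
  have hlt : C.height (C.minChild u) < C.height (C.maxChild u) := by
    have h1 := height_le_maxH hz
    have h2 := height_le_maxH hz'
    have h3 := minH_le_height hz
    have h4 := minH_le_height hz'
    rcases lt_abs.1 hgap with h | h <;> omega
  have hml : ¬ C.IsLeaf (C.maxChild u) := by
    intro hleaf
    rcases hm with ⟨-, h0⟩ | ⟨hn, -⟩
    · have := hC.1 (C.minChild u)
      omega
    · exact hn hleaf
  exact ⟨hlt, (hC.2 _ _ (maxChild_spec hml).1).trans (hC.2 _ _ hmaxp)⟩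

section Step

variable {α : ℤ} {C C' : PreConfig V} {A : Finset V}

theorem Step.height_lt (hs : Step α C C' A) (hC : C.Increasing) {u : V} (hA : u ∈ A)
    (hu : C.UpdateEnabled u) : C'.height u < C.height u :=
  hs.height_update u hA hu ▸ hC.newHeight_lt hu

theorem Step.height_le (hs : Step α C C' A) (hC : C.Increasing) (u : V) :
    C'.height u ≤ C.height u := by
  by_cases h : u ∈ A ∧ C.UpdateEnabled u
  · exact (hs.height_lt hC h.1 h.2).le
  · exact (hs.height_keep u h).le

theorem Step.height_eq_of_stable (hs : Step α C C' A) {u : V} (hu : C.Stable u) :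
    C'.height u = C.height u :=
  hs.height_keep u fun h => h.2 hu

theorem Step.increasing (hα : 1 ≤ α) (hs : Step α C C' A) (hC : C.Increasing) :
    C'.Increasing := by
  refine ⟨fun u => ?_, fun v p hp => ?_⟩
  · by_cases h : u ∈ A ∧ C.UpdateEnabled u
    · exact hs.height_update u h.1 h.2 ▸ hC.newHeight_nonneg u
    · exact hs.height_keep u h ▸ hC.1 u
  · refine (hs.height_le hC v).trans_lt ?_
    by_cases hsw : ∃ u ∈ A, SwapEnabled α C u ∧
        (v = C.minChild u ∨ v = C.maxChild (C.maxChild u))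
    · obtain ⟨u, hA, hu, rfl | rfl⟩ := hsw
      · obtain rfl := Option.some.inj ((hs.swap_out u hA hu).symm.trans hp)
        exact hs.height_eq_of_stable hu.2.1 ▸ (hC.swap_height_lt hα hu).1
      · obtain rfl := Option.some.inj ((hs.swap_in u hA hu).symm.trans hp)
        exact hs.height_eq_of_stable hu.1 ▸ (hC.swap_height_lt hα hu).2
    · rw [hs.parent_keep v fun u hA hu =>
        ⟨fun h => hsw ⟨u, hA, hu, Or.inl h⟩, fun h => hsw ⟨u, hA, hu, Or.inr h⟩⟩] at hp
      by_cases h : p ∈ A ∧ C.UpdateEnabled p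
      · exact hs.height_update p h.1 h.2 ▸ height_lt_newHeight hp
      · exact hs.height_keep p h ▸ hC.2 v p hp

theorem Step.sum_height_le (hs : Step α C C' A) (hC : C.Increasing) :
    ∑ u, (C'.height u).toNat ≤ ∑ u, (C.height u).toNat :=
  Finset.sum_le_sum fun u _ => Int.toNat_le_toNat (hs.height_le hC u)

theorem Step.sum_height_lt (hα : 1 ≤ α) (hs : Step α C C' A) (hC : C.Increasing) {u : V}
    (hA : u ∈ A) (hu : C.UpdateEnabled u) :
    ∑ u, (C'.height u).toNat < ∑ u, (C.height u).toNat := by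
  refine Finset.sum_lt_sum (fun v _ => Int.toNat_le_toNat (hs.height_le hC v))
    ⟨u, Finset.mem_univ u, ?_⟩
  have h1 := hs.height_lt hC hA hu
  have h2 := (hs.increasing hα hC).1 u
  omega

end Step

end PreConfig

/-- In any execution whose initial configuration contains no bad nodes,
the total number of height-update actions performed (summed over all steps and all
activated nodes) is finite. -/
theorem stmt4 {V : Type*} [Fintype V] [LinearOrder V] (α : ℤ) (hα : 1 ≤ α)
    (Cs : ℕ → PreConfig V) (As : ℕ → Finset V) (r : V)
    (hT : (Cs 0).IsTree r)
    (hstep : ∀ n, PreConfig.Step α (Cs n) (Cs (n + 1)) (As n))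
    (hbad : ∀ u, ¬ (Cs 0).Bad u) :
    {p : ℕ × V | p.2 ∈ As p.1 ∧ PreConfig.UpdateEnabled (Cs p.1) p.2}.Finite := by
  have hinc : ∀ n, (Cs n).Increasing := fun n => by
    induction n with
    | zero => exact PreConfig.increasing_of_not_bad hbad
    | succ n ih => exact (hstep n).increasing hα ih
  let φ : ℕ → ℕ := fun n => ∑ u, ((Cs n).height u).toNat
  have hφ : Antitone φ := antitone_nat_of_succ_le fun n => (hstep n).sum_height_le (hinc n)
  let N := Function.argmin φ
  refine ((Set.finite_Iio N).prod Set.finite_univ).subset ?_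
  rintro ⟨n, u⟩ ⟨hA, hu⟩
  refine ⟨?_, Set.mem_univ u⟩
  by_contra hn
  have h1 : φ (n + 1) < φ n := (hstep n).sum_height_lt hα (hinc n) hA hu
  have h2 : φ n ≤ φ N := hφ (not_lt.1 hn)
  exact absurd (Function.argmin_le φ (n + 1)) (not_le.2 (h1.trans_le h2))
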